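/- Let r ≥ 1, let x, x' ∈ ℝ^r with ‖x − x'‖₂ ≤ Δ for some Δ > 0, let δ ∈ (0,1) and ε ∈ (0,1), and set σ = Δ·√(2·ln(1.25/δ))/ε. Then the multivariate Gaussian mechanism with noise standard deviation σ is (ε, δ)-indistinguishable at x and x': for every measurable set S ⊆ ℝ^r, μ_x(S) ≤ e^ε · μ_{x'}(S) + δ, where μ_y denotes the Gaussian probability measure N(y, σ² I_r) on ℝ^r. -/

import Mathlib

open MeasureTheory ProbabilityTheory

/-- The Gaussian probability measure `N(y, σ² I_r)` on `ℝ^r`: product of `r` independent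
one-dimensional Gaussians with means `y q` and common variance `σ²`. -/
noncomputable def gaussVec (r : ℕ) (y : Fin r → ℝ) (σ : ℝ) : Measure (Fin r → ℝ) :=
  Measure.pi (fun q => gaussianReal (y q) (Real.toNNReal (σ ^ 2)))

lemma gaussianReal_eq_withDensity_gaussianReal (a b : ℝ) {v : NNReal} (hv : v ≠ 0) :
    gaussianReal a v = (gaussianReal b v).withDensity
      (fun z => ENNReal.ofReal (Real.exp (((z - b) ^ 2 - (z - a) ^ 2) / (2 * v)))) := by
  rw [gaussianReal_of_var_ne_zero a hv, gaussianReal_of_var_ne_zero b hv,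
    ← withDensity_mul _ (measurable_gaussianPDF b v) (by fun_prop)]
  congr 1
  ext z
  simp only [gaussianPDF_def, Pi.mul_apply]
  rw [← ENNReal.ofReal_mul (gaussianPDFReal_nonneg _ _ _)]
  simp only [gaussianPDFReal_def]
  rw [mul_assoc _ (Real.exp _) (Real.exp _), ← Real.exp_add]
  congr 3
  ring

lemma pi_withDensity {ι : Type*} [Fintype ι] {α : ι → Type*} [∀ i, MeasurableSpace (α i)]
    (μ : ∀ i, Measure (α i)) [∀ i, IsProbabilityMeasure (μ i)] (f : ∀ i, α i → ENNReal)
    (hf : ∀ i, Measurable (f i)) [∀ i, SigmaFinite ((μ i).withDensity (f i))] :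
    Measure.pi (fun i => (μ i).withDensity (f i))
      = (Measure.pi μ).withDensity (fun z => ∏ i, f i (z i)) := by
  refine Measure.pi_eq fun s hs => ?_
  have hg : ∀ i, Measurable ((s i).indicator (f i)) := fun i => (hf i).indicator (hs i)
  have hind := iIndepFun_pi (μ := μ) (X := fun i => (s i).indicator (f i))
    fun i => (hg i).aemeasurable
  have hprod := lintegral_prod_eq_prod_lintegral_of_indepFun Finset.univ _ hind
    fun i => (hg i).comp (measurable_pi_apply i)
  rw [withDensity_apply _ (MeasurableSet.univ_pi hs),
    ← lintegral_indicator (MeasurableSet.univ_pi hs)]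
  calc _ = ∫⁻ z, ∏ i, (s i).indicator (f i) (z i) ∂Measure.pi μ := by
        refine lintegral_congr fun z => ?_
        by_cases hz : z ∈ Set.univ.pi s
        · rw [Set.indicator_of_mem hz]
          exact Finset.prod_congr rfl fun i _ =>
            (Set.indicator_of_mem (hz i (Set.mem_univ i)) _).symm
        · rw [Set.indicator_of_notMem hz]
          simp only [Set.mem_univ_pi, not_forall] at hz
          obtain ⟨i, hi⟩ := hz
          exact (Finset.prod_eq_zero (Finset.mem_univ i) (Set.indicator_of_notMem hi _)).symm
    _ = _ := by
        rw [hprod]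
        refine Finset.prod_congr rfl fun i _ => ?_
        rw [withDensity_apply _ (hs i), ← lintegral_indicator (hs i),
          ← (measurePreserving_eval μ i).lintegral_comp (hg i)]

lemma map_sum_mul_pi_gaussianReal {ι : Type*} [Fintype ι] (a m : ι → ℝ) (v : NNReal) :
    (Measure.pi fun i => gaussianReal (m i) v).map (fun z => ∑ i, a i * z i)
      = gaussianReal (∑ i, a i * m i) (∑ i, NNReal.mk (a i ^ 2) (sq_nonneg _) * v) := by
  have hind := iIndepFun_pi (μ := fun i => gaussianReal (m i) v) (X := fun i z => a i * z)
    fun i => by fun_prop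
  have hmap : ∀ i, (Measure.pi fun i => gaussianReal (m i) v).map (fun z => a i * z i)
      = gaussianReal (a i * m i) (NNReal.mk (a i ^ 2) (sq_nonneg _) * v) := fun i => by
    rw [← gaussianReal_map_const_mul,
      ← (measurePreserving_eval (fun i => gaussianReal (m i) v) i).map_eq,
      Measure.map_map (by fun_prop) (by fun_prop)]
    rfl
  have := Measure.isProbabilityMeasure_map (μ := Measure.pi fun i => gaussianReal (m i) v)
    (f := fun z => ∑ i, a i * z i)
    (Measurable.aemeasurable (by fun_prop))
  refine Measure.ext_of_charFun ?_
  rw [hind.charFun_map_fun_sum_eq_prod fun i => Measurable.aemeasurable (by fun_prop)]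
  ext t
  simp only [Finset.prod_apply, hmap, charFun_gaussianReal, ← Complex.exp_sum]
  congr 1
  push_cast
  simp only [Finset.sum_sub_distrib, Finset.mul_sum, Finset.sum_mul, Finset.sum_div]

lemma gaussianReal_Ioi_mean_le (m : ℝ) {v : NNReal} :
    gaussianReal m v (Set.Ioi m) ≤ ENNReal.ofReal (1 / 2) := by
  have hsymm : gaussianReal m v (Set.Ioi m) = gaussianReal m v (Set.Iio m) := by
    have h := gaussianReal_map_const_sub (μ := m) (v := v) (2 * m)
    rw [show 2 * m - m = m by ring] at h
    conv_lhs => rw [← h]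
    rw [Measure.map_apply (by fun_prop) measurableSet_Ioi]
    congr 1
    ext z
    simp only [Set.mem_preimage, Set.mem_Ioi, Set.mem_Iio]
    constructor <;> intro <;> linarith
  have hle : gaussianReal m v (Set.Ioi m) + gaussianReal m v (Set.Ioi m) ≤ 1 := by
    nth_rewrite 2 [hsymm]
    rw [← measure_union (by
      exact Set.disjoint_left.2 fun z (hz : m < z) (hz' : z < m) => lt_asymm hz hz') measurableSet_Iio]
    exact prob_le_one
  rw [ENNReal.le_ofReal_iff_toReal_le (measure_ne_top _ _) (by norm_num)]
  have := ENNReal.toReal_mono ENNReal.one_ne_top hle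
  rw [ENNReal.toReal_add (measure_ne_top _ _) (measure_ne_top _ _), ENNReal.toReal_one] at this
  linarith

lemma withDensity_exp_apply_le {α : Type*} [MeasurableSpace α] (ν : Measure α) (L : α → ℝ)
    {S : Set α} (hS : MeasurableSet S) {b : ℝ} (hb : ∀ z ∈ S, L z ≤ b) :
    ν.withDensity (fun z => ENNReal.ofReal (Real.exp (L z))) S
      ≤ ENNReal.ofReal (Real.exp b) * ν S := by
  rw [withDensity_apply _ hS, ← setLIntegral_const]
  refine setLIntegral_mono' hS fun z hz => ?_
  gcongr
  exact hb z hz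

lemma gaussianReal_Ioi_add_le_exp (m : ℝ) {t : ℝ} (ht : 0 ≤ t) :
    gaussianReal m 1 (Set.Ioi (m + t)) ≤ ENNReal.ofReal (1 / 2 * Real.exp (-t ^ 2 / 2)) := by
  rw [gaussianReal_eq_withDensity_gaussianReal m (m + t) one_ne_zero]
  refine (withDensity_exp_apply_le _ _ measurableSet_Ioi (b := -t ^ 2 / 2) ?_).trans ?_
  · intro z hz
    have hz' : m + t < z := hz
    simp only [NNReal.coe_one]
    nlinarith
  · rw [mul_comm (1 / 2 : ℝ), ENNReal.ofReal_mul (Real.exp_pos _).le]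
    gcongr
    exact gaussianReal_Ioi_mean_le _

lemma gaussianReal_Ioi_sub_le (m : ℝ) {a : ℝ} (ha : 0 ≤ a) :
    gaussianReal m 1 (Set.Ioi (m - a)) ≤ ENNReal.ofReal (1 / 2 + a) := by
  rw [← Set.Ioc_union_Ioi_eq_Ioi (show m - a ≤ m by linarith), add_comm (1 / 2 : ℝ),
    ENNReal.ofReal_add ha (by norm_num)]
  refine (measure_union_le _ _).trans (add_le_add ?_ (gaussianReal_Ioi_mean_le m))
  have hpdf : ∀ z, gaussianPDF m 1 z ≤ 1 := fun z => by
    rw [gaussianPDF_def, ENNReal.ofReal_le_one, gaussianPDFReal_def]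
    refine mul_le_one₀ (inv_le_one_of_one_le₀ ?_) (Real.exp_pos _).le ?_
    · rw [Real.one_le_sqrt, NNReal.coe_one]
      linarith [Real.pi_gt_three]
    · rw [Real.exp_le_one_iff, NNReal.coe_one]
      nlinarith [sq_nonneg (z - m)]
  rw [gaussianReal_apply _ one_ne_zero]
  calc _ ≤ ∫⁻ _ in Set.Ioc (m - a) m, 1 := lintegral_mono hpdf
    _ = ENNReal.ofReal a := by simp

lemma gaussianReal_Ioi_add_le_of_eq_exp {c δ t : ℝ} (m : ℝ) (hc : 0 < c) (hδ1 : δ < 1)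
    (hcδ : δ = 1.25 * Real.exp (-c ^ 2 / 2)) (ht : c - 1 / (2 * c) ≤ t) :
    gaussianReal m 1 (Set.Ioi (m + t)) ≤ ENNReal.ofReal δ := by
  have hcc : c * (1 / (2 * c)) = 1 / 2 := by field_simp
  refine (measure_mono (Set.Ioi_subset_Ioi (by gcongr))).trans
    (b := gaussianReal m 1 (Set.Ioi (m + (c - 1 / (2 * c))))) ?_
  generalize 1 / (2 * c) = q at *
  rcases le_total 0 (c - q) with h | h
  · refine (gaussianReal_Ioi_add_le_exp m h).trans (ENNReal.ofReal_le_ofReal ?_)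
    have hexp : Real.exp (1 / 2) ≤ 2.5 := by
      have h1 : Real.exp (1 / 2) * Real.exp (1 / 2) = Real.exp 1 := by
        rw [← Real.exp_add]; norm_num
      nlinarith [Real.exp_one_lt_d9, Real.exp_pos (1 / 2)]
    calc 1 / 2 * Real.exp (-(c - q) ^ 2 / 2)
        ≤ 1 / 2 * Real.exp (1 / 2 + -c ^ 2 / 2) := by
          gcongr
          nlinarith [sq_nonneg q]
      _ ≤ δ := by
          rw [Real.exp_add, hcδ]
          nlinarith [Real.exp_pos (-c ^ 2 / 2)]
  · rw [show m + (c - q) = m - (q - c) by ring]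
    refine (gaussianReal_Ioi_sub_le m (by linarith)).trans (ENNReal.ofReal_le_ofReal ?_)
    have hcsq : c ^ 2 ≤ 1 / 2 := by nlinarith
    have hδ : 0.9375 ≤ δ := by
      rw [hcδ]
      nlinarith [Real.add_one_le_exp (-c ^ 2 / 2)]
    have hc_lower : 0.6 ≤ c := by
      have hinv : Real.exp (-c ^ 2 / 2) * Real.exp (c ^ 2 / 2) = 1 := by
        rw [← Real.exp_add, ← Real.exp_zero]; ring_nf
      have := Real.add_one_le_exp (-c ^ 2 / 2)
      by_contra! hlt
      nlinarith
    nlinarith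

lemma gaussVec_eq_withDensity_gaussVec (r : ℕ) (x x' : Fin r → ℝ) {σ : ℝ} (hσ : 0 < σ) :
    gaussVec r x σ = (gaussVec r x' σ).withDensity (fun z => ENNReal.ofReal (Real.exp
      (∑ q, ((z q - x' q) ^ 2 - (z q - x q) ^ 2) / (2 * σ ^ 2)))) := by
  have hv : Real.toNNReal (σ ^ 2) ≠ 0 := by simpa using hσ.ne'
  have hcoe : ((σ ^ 2).toNNReal : ℝ) = σ ^ 2 := Real.coe_toNNReal _ (sq_nonneg σ)
  have key := fun q => gaussianReal_eq_withDensity_gaussianReal (x q) (x' q) hv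
  have : ∀ q, SigmaFinite ((gaussianReal (x' q) (σ ^ 2).toNNReal).withDensity
      (fun z => ENNReal.ofReal (Real.exp
        (((z - x' q) ^ 2 - (z - x q) ^ 2) / (2 * (σ ^ 2).toNNReal))))) := fun q => by
    rw [← key q]; infer_instance
  unfold gaussVec
  simp_rw [key]
  rw [pi_withDensity _ _ fun q => by fun_prop]
  congr 1
  ext z
  rw [Real.exp_sum, ENNReal.ofReal_prod_of_nonneg fun q _ => (Real.exp_pos _).le, hcoe]

/-- Gaussian mechanism: if `‖x - x'‖₂ ≤ Δ`, `δ, ε ∈ (0,1)` and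
`σ = Δ √(2 ln(1.25/δ)) / ε`, then for every measurable `S ⊆ ℝ^r`,
`N(x, σ² I_r)(S) ≤ e^ε N(x', σ² I_r)(S) + δ`. -/
theorem stmt16 (r : ℕ) (hr : 1 ≤ r)
    (x x' : Fin r → ℝ) (Δ : ℝ) (hΔ : 0 < Δ)
    (hdist : Real.sqrt (∑ q, (x q - x' q) ^ 2) ≤ Δ)
    (δ ε : ℝ) (hδ0 : 0 < δ) (hδ1 : δ < 1) (hε0 : 0 < ε) (hε1 : ε < 1) :
    ∀ S : Set (Fin r → ℝ), MeasurableSet S →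
      gaussVec r x (Δ * Real.sqrt (2 * Real.log (1.25 / δ)) / ε) S
        ≤ ENNReal.ofReal (Real.exp ε)
            * gaussVec r x' (Δ * Real.sqrt (2 * Real.log (1.25 / δ)) / ε) S
          + ENNReal.ofReal δ := by
  intro S hS
  have hlog : 0 < Real.log (1.25 / δ) := Real.log_pos (by rw [lt_div_iff₀ hδ0]; linarith)
  have hc : 0 < Real.sqrt (2 * Real.log (1.25 / δ)) := Real.sqrt_pos.2 (by linarith)
  have hcδ : δ = 1.25 * Real.exp (-Real.sqrt (2 * Real.log (1.25 / δ)) ^ 2 / 2) := by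
    rw [Real.sq_sqrt (by linarith), show -(2 * Real.log (1.25 / δ)) / 2
      = -Real.log (1.25 / δ) by ring, Real.exp_neg, Real.exp_log (by positivity)]
    field_simp
  generalize Real.sqrt (2 * Real.log (1.25 / δ)) = c at *
  have hσ : 0 < Δ * c / ε := by positivity
  have hσε : Δ * c / ε * ε = Δ * c := by field_simp
  generalize Δ * c / ε = σ at *
  have hDsq := Real.sq_sqrt (Finset.sum_nonneg fun q (_ : q ∈ Finset.univ) =>
    sq_nonneg (x q - x' q))
  rcases (Real.sqrt_nonneg (∑ q, (x q - x' q) ^ 2)).eq_or_lt' with hD | hD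
  · have hxx' : x = x' := by
      rw [hD] at hDsq
      ext q
      have := (Finset.sum_eq_zero_iff_of_nonneg fun q _ => sq_nonneg (x q - x' q)).1
        (by simpa using hDsq.symm) q (Finset.mem_univ q)
      exact sub_eq_zero.1 (by simpa using this)
    subst hxx'
    refine le_add_right (le_mul_of_one_le_left' ?_)
    rw [ENNReal.one_le_ofReal]
    exact Real.one_le_exp hε0.le
  generalize Real.sqrt (∑ q, (x q - x' q) ^ 2) = D at *
  set L : (Fin r → ℝ) → ℝ := fun z =>
    ∑ q, ((z q - x' q) ^ 2 - (z q - x q) ^ 2) / (2 * σ ^ 2) with hL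
  have hLmeas : Measurable L := by fun_prop
  have hLset : MeasurableSet {z | L z ≤ ε} := measurableSet_le hLmeas measurable_const
  have htail : gaussVec r x σ {z | L z ≤ ε}ᶜ ≤ ENNReal.ofReal δ := by
    let a : Fin r → ℝ := fun q => (x q - x' q) / (σ * D)
    have hvar : ∑ q, NNReal.mk (a q ^ 2) (sq_nonneg _) * Real.toNNReal (σ ^ 2) = 1 := by
      rw [← NNReal.coe_inj]
      push_cast
      rw [Real.coe_toNNReal _ (sq_nonneg σ), ← Finset.sum_mul]
      change (∑ q, ((x q - x' q) / (σ * D)) ^ 2) * σ ^ 2 = 1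
      simp only [div_pow]
      rw [← Finset.sum_div, ← hDsq]
      field_simp
    have hmap := map_sum_mul_pi_gaussianReal a x (Real.toNNReal (σ ^ 2))
    rw [hvar] at hmap
    have ht : c - 1 / (2 * c) ≤ ε * σ / D - D / (2 * σ) := by
      have h1 : c ≤ ε * σ / D := by rw [le_div_iff₀ hD]; nlinarith
      have h2 : D / (2 * σ) ≤ 1 / (2 * c) := by
        rw [div_le_div_iff₀ (by positivity) (by positivity)]
        nlinarith
      linarith
    refine le_trans (le_of_eq ?_) (gaussianReal_Ioi_add_le_of_eq_exp (∑ q, a q * x q) hc hδ1 hcδ ht)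
    rw [← hmap, Measure.map_apply (by fun_prop) measurableSet_Ioi]
    unfold gaussVec
    congr 1
    ext z
    have hLz : L z = D / σ * (∑ q, a q * z q - ∑ q, a q * x q) + D ^ 2 / (2 * σ ^ 2) := by
      rw [hDsq, hL, ← Finset.sum_sub_distrib, Finset.mul_sum, Finset.sum_div,
        ← Finset.sum_add_distrib]
      refine Finset.sum_congr rfl fun q _ => ?_
      simp only [a]
      field_simp
      ring
    have hεD : ε = D / σ * (ε * σ / D - D / (2 * σ)) + D ^ 2 / (2 * σ ^ 2) := by
      field_simp
      ring
    have hDσ : 0 < D / σ := by positivity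
    simp only [Set.mem_compl_iff, Set.mem_ofPred_eq, not_le, Set.mem_preimage, Set.mem_Ioi]
    rw [hLz]
    conv_lhs => lhs; rw [hεD]
    rw [add_lt_add_iff_right, mul_lt_mul_iff_right₀ hDσ, lt_sub_iff_add_lt, add_comm]
  calc gaussVec r x σ S
      ≤ gaussVec r x σ (S ∩ {z | L z ≤ ε}) + gaussVec r x σ {z | L z ≤ ε}ᶜ := by
        refine (measure_mono fun z hz => ?_).trans (measure_union_le _ _)
        by_cases h : L z ≤ ε
        · exact Or.inl ⟨hz, h⟩
        · exact Or.inr h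
    _ ≤ _ := by
        refine add_le_add ?_ htail
        rw [gaussVec_eq_withDensity_gaussVec r x x' hσ]
        refine (withDensity_exp_apply_le _ L (hS.inter hLset) fun z hz => hz.2).trans ?_
        gcongr
        exact Set.inter_subset_left
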